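/- There exists a constant C > 0 such that the following holds. Let Y₁, …, Y_n be i.i.d. χ²₁ random variables with order statistics Y₍₁₎ ≥ … ≥ Y₍ₙ₎, let k satisfy k/n < 1/5, define T_k = √((1/k)·Σ_{i=1}^k Y₍ᵢ₎), let t be defined by P(Y₁ > t) = k/n, and set T = √(E(Y₁ | Y₁ > t)). Then for every ε > 0, P(|T_k − T| > C/√(k·log(n/k)) + ε) ≤ 2e^{−kε²/2}. -/

import Mathlib

open MeasureTheory ProbabilityTheory

/-- The χ²₁ distribution: law of the square of a standard Gaussian. -/
noncomputable def chiSq1 : Measure ℝ := (gaussianReal 0 1).map (· ^ 2)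

/-- Conditional expectation `E(Y | Y > t)` for `Y ~ chiSq1`. -/
noncomputable def condExpGt (t : ℝ) : ℝ :=
  (∫ y in Set.Ioi t, y ∂chiSq1) / (chiSq1 (Set.Ioi t)).toReal

/-- Sum of the top `k` order statistics `Y_(1) + ⋯ + Y_(k)` of `Y : Fin n → ℝ`
(for nonnegative `Y` and `k ≤ n`), realized as the largest sum over index sets of size `k`. -/
noncomputable def topSum (n k : ℕ) (Y : Fin n → ℝ) : ℝ :=
  sSup ((fun S : Finset (Fin n) => ∑ i ∈ S, Y i) '' {S | S.card = k})

open scoped Pointwise in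
theorem IsCompact.volume_add_le_volume_add {K K' : Set ℝ} (hK : IsCompact K) (hK' : IsCompact K')
    (h : K.Nonempty) (h' : K'.Nonempty) : volume K + volume K' ≤ volume (K + K') := by
  obtain ⟨a, ha, hau⟩ := hK.exists_isGreatest h
  obtain ⟨b, hb, hbl⟩ := hK'.exists_isLeast h'
  have hle : volume ((fun x => x + b) '' K ∪ (fun x => a + x) '' K') ≤ volume (K + K') := by
    apply measure_mono
    rintro _ (⟨x, hx, rfl⟩ | ⟨x, hx, rfl⟩)
    · exact Set.add_mem_add hx hb
    · exact Set.add_mem_add ha hx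
  refine le_trans (le_of_eq ?_) hle
  rw [measure_union₀ ((hK'.image (by fun_prop)).measurableSet.nullMeasurableSet)]
  · rw [Set.image_add_left, Set.image_add_right, measure_preimage_add, measure_preimage_add_right]
  · refine measure_mono_null (t := {a + b}) ?_ (by simp)
    rintro _ ⟨⟨x, hx, rfl⟩, ⟨y, hy, hxy⟩⟩
    have h1 := hau hx
    have h2 := hbl hy
    simp only at hxy
    simp only [Set.mem_singleton_iff]
    linarith

/-- One-dimensional Brunn–Minkowski inequality. -/
theorem volume_convex_combination_le {A B H : Set ℝ} (hA : MeasurableSet A) (hB : MeasurableSet B)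
    (hA0 : A.Nonempty) (hB0 : B.Nonempty) {s : ℝ} (hs0 : 0 ≤ s) (hs1 : s ≤ 1)
    (hH : ∀ a ∈ A, ∀ b ∈ B, (1 - s) * a + s * b ∈ H) :
    ENNReal.ofReal (1 - s) * volume A + ENNReal.ofReal s * volume B ≤ volume H := by
  obtain ⟨a, ha⟩ := hA0
  obtain ⟨b, hb⟩ := hB0
  rw [hA.measure_eq_iSup_isCompact, hB.measure_eq_iSup_isCompact]
  simp only [ENNReal.mul_iSup, iSup_and']
  refine ENNReal.biSup_add_biSup_le' ⟨∅, by simp⟩ ⟨∅, by simp⟩ ?_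
  intro K ⟨hKA, hK⟩ K' ⟨hKB, hK'⟩
  have key := ((hK.insert a).image (f := fun x => (1 - s) * x) (by fun_prop)).volume_add_le_volume_add
    ((hK'.insert b).image (f := fun x => s * x) (by fun_prop))
    ((Set.insert_nonempty _ _).image _) ((Set.insert_nonempty _ _).image _)
  have scale : ∀ (r : ℝ) (S : Set ℝ), 0 ≤ r →
      volume ((fun x => r * x) '' S) = ENNReal.ofReal r * volume S := by
    intro r S hr
    have := Measure.addHaar_smul (volume : Measure ℝ) r S
    rw [Module.finrank_self, pow_one, abs_of_nonneg hr] at this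
    exact this
  rw [scale _ _ (by linarith), scale _ _ hs0] at key
  calc _ ≤ ENNReal.ofReal (1 - s) * volume (insert a K)
        + ENNReal.ofReal s * volume (insert b K') := by
        gcongr <;> exact Set.subset_insert _ _
    _ ≤ _ := key
    _ ≤ volume H := by
        apply measure_mono
        rintro _ ⟨_, ⟨x, hx, rfl⟩, _, ⟨y, hy, rfl⟩, rfl⟩
        exact hH x (Set.insert_subset ha hKA hx) y (Set.insert_subset hb hKB hy)

theorem rpow_mul_rpow_gt {s : ℝ} (hs0 : 0 < s) (hs1 : s < 1) {τ a b : ℝ} (hτ : 0 ≤ τ)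
    (ha : τ < a) (hb : τ < b) : τ < a ^ (1 - s) * b ^ s := by
  have h1 : τ ^ (1 - s) * τ ^ s = τ := by
    rcases hτ.eq_or_lt with h | h
    · rw [← h, Real.zero_rpow hs0.ne', mul_zero]
    · rw [← Real.rpow_add h]; simp
  calc τ = τ ^ (1 - s) * τ ^ s := h1.symm
    _ < a ^ (1 - s) * b ^ s := by
      apply mul_lt_mul'' _ _ (by positivity) (by positivity)
      · exact Real.rpow_lt_rpow hτ ha (by linarith)
      · exact Real.rpow_lt_rpow hτ hb hs0

/-- Arithmetic form of the one-dimensional Prékopa–Leindler inequality, for functions with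
supremum `1`. -/
theorem lintegral_convex_combination_le {f g h : ℝ → ℝ} (hf : Measurable f) (hg : Measurable g)
    (hh : Measurable h) (hf0 : ∀ x, 0 ≤ f x) (hg0 : ∀ x, 0 ≤ g x) (hh0 : ∀ x, 0 ≤ h x)
    (hf1 : IsLUB (Set.range f) 1) (hg1 : IsLUB (Set.range g) 1)
    {s : ℝ} (hs0 : 0 < s) (hs1 : s < 1)
    (H : ∀ x y, f x ^ (1 - s) * g y ^ s ≤ h ((1 - s) * x + s * y)) :
    ENNReal.ofReal (1 - s) * (∫⁻ x, ENNReal.ofReal (f x)) +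
      ENNReal.ofReal s * (∫⁻ x, ENNReal.ofReal (g x)) ≤ ∫⁻ x, ENNReal.ofReal (h x) := by
  rw [lintegral_eq_lintegral_meas_lt _ (Filter.Eventually.of_forall hf0) hf.aemeasurable,
    lintegral_eq_lintegral_meas_lt _ (Filter.Eventually.of_forall hg0) hg.aemeasurable,
    lintegral_eq_lintegral_meas_lt _ (Filter.Eventually.of_forall hh0) hh.aemeasurable]
  have meas : ∀ f : ℝ → ℝ, Measurable (fun t : ℝ => volume {a | t < f a}) := fun f =>
    Antitone.measurable fun t t' htt => measure_mono fun a (ha : t' < f a) => htt.trans_lt ha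
  rw [← lintegral_const_mul _ (meas f), ← lintegral_const_mul _ (meas g),
    ← lintegral_add_left ((meas f).const_mul _)]
  refine setLIntegral_mono (meas h) fun τ (hτ : 0 < τ) => ?_
  by_cases hτ1 : τ < 1
  · obtain ⟨_, ⟨x, rfl⟩, hx⟩ := (lt_isLUB_iff hf1).1 hτ1
    obtain ⟨_, ⟨y, rfl⟩, hy⟩ := (lt_isLUB_iff hg1).1 hτ1
    exact volume_convex_combination_le (hf measurableSet_Ioi) (hg measurableSet_Ioi)
      ⟨x, hx⟩ ⟨y, hy⟩ hs0.le hs1.le fun a ha b hb =>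
        (rpow_mul_rpow_gt hs0 hs1 hτ.le ha hb).trans_le (H a b)
  · have e : ∀ f : ℝ → ℝ, IsLUB (Set.range f) 1 → {a | τ < f a} = ∅ := by
      intro f hf
      ext a
      simpa using (hf.1 ⟨a, rfl⟩).trans (not_lt.1 hτ1)
    simp [e f hf1, e g hg1]

/-- One-dimensional Prékopa–Leindler inequality for bounded integrable functions. -/
theorem prekopa_leindler {f g h : ℝ → ℝ} (hf : Measurable f) (hg : Measurable g)
    (hh : Measurable h) (hf0 : ∀ x, 0 ≤ f x) (hg0 : ∀ x, 0 ≤ g x) (hh0 : ∀ x, 0 ≤ h x)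
    (hfb : BddAbove (Set.range f)) (hgb : BddAbove (Set.range g))
    (hfi : Integrable f) (hgi : Integrable g) (hhi : Integrable h)
    {s : ℝ} (hs0 : 0 < s) (hs1 : s < 1)
    (H : ∀ x y, f x ^ (1 - s) * g y ^ s ≤ h ((1 - s) * x + s * y)) :
    (∫ x, f x) ^ (1 - s) * (∫ x, g x) ^ s ≤ ∫ x, h x := by
  have hlf := isLUB_ciSup hfb
  have hlg := isLUB_ciSup hgb
  set a := ⨆ x, f x
  set b := ⨆ x, g x
  have hs1' : 0 < 1 - s := by linarith
  have hI : 0 ≤ ∫ x, h x := integral_nonneg hh0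
  have ha0 : 0 ≤ a := (hf0 0).trans (hlf.1 ⟨0, rfl⟩)
  have hb0 : 0 ≤ b := (hg0 0).trans (hlg.1 ⟨0, rfl⟩)
  rcases ha0.eq_or_lt with ha | ha
  · have : f = 0 := by
      ext x; exact le_antisymm ((hlf.1 ⟨x, rfl⟩).trans ha.ge) (hf0 x)
    simpa [this, Real.zero_rpow hs1'.ne'] using hI
  rcases hb0.eq_or_lt with hb | hb
  · have : g = 0 := by
      ext x; exact le_antisymm ((hlg.1 ⟨x, rfl⟩).trans hb.ge) (hg0 x)
    simpa [this, Real.zero_rpow hs0.ne'] using hI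
  have lub : ∀ (f : ℝ → ℝ) (a : ℝ), 0 < a → IsLUB (Set.range f) a →
      IsLUB (Set.range fun x => f x / a) 1 := by
    intro f a ha h
    constructor
    · rintro _ ⟨x, rfl⟩
      exact (div_le_one ha).2 (h.1 ⟨x, rfl⟩)
    · intro c hc
      have : a ≤ c * a := h.2 (by rintro _ ⟨x, rfl⟩; exact (div_le_iff₀ ha).1 (hc ⟨x, rfl⟩))
      nlinarith
  set c := a ^ (1 - s) * b ^ s with hc
  have hc0 : 0 < c := by positivity
  have key := lintegral_convex_combination_le (hf.div_const a) (hg.div_const b) (hh.div_const c)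
    (fun x => by have := hf0 x; positivity) (fun x => by have := hg0 x; positivity)
    (fun x => by have := hh0 x; positivity) (lub f a ha hlf) (lub g b hb hlg) hs0 hs1
    (fun x y => by
      rw [Real.div_rpow (hf0 x) ha.le, Real.div_rpow (hg0 y) hb.le, div_mul_div_comm]
      gcongr
      exact H x y)
  have conv : ∀ (f : ℝ → ℝ) (a : ℝ), (∀ x, 0 ≤ f x) → 0 < a → Integrable f →
      ∫⁻ x, ENNReal.ofReal (f x / a) = ENNReal.ofReal ((∫ x, f x) / a) := by
    intro f a hf ha hi
    rw [← ofReal_integral_eq_lintegral_ofReal (hi.div_const a)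
      (Filter.Eventually.of_forall fun x => by have := hf x; simp only [Pi.zero_apply]; positivity),
      integral_div]
  have hIf : 0 ≤ ∫ x, f x := integral_nonneg hf0
  have hIg : 0 ≤ ∫ x, g x := integral_nonneg hg0
  rw [conv f a hf0 ha hfi, conv g b hg0 hb hgi, conv h c hh0 hc0 hhi,
    ← ENNReal.ofReal_mul hs1'.le, ← ENNReal.ofReal_mul hs0.le,
    ← ENNReal.ofReal_add (by positivity) (by positivity),
    ENNReal.ofReal_le_ofReal_iff (by positivity)] at key
  have am := Real.geom_mean_le_arith_mean2_weighted hs1'.le hs0.le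
    (div_nonneg hIf ha.le) (div_nonneg hIg hb.le) (by ring)
  rw [Real.div_rpow hIf ha.le, Real.div_rpow hIg hb.le, div_mul_div_comm] at am
  exact (div_le_div_iff_of_pos_right hc0).1 (am.trans key)

/-- The Maurey-type form of the Prékopa–Leindler inequality for a measure `μ`, with quadratic
cost `d` and weight `s`. -/
def MaureyProperty {E : Type*} [MeasurableSpace E] (μ : Measure E) (d : E → E → ℝ) (s : ℝ) : Prop :=
  ∀ u v : E → ℝ, Measurable u → Measurable v → (∀ x, 0 ≤ u x) → (∀ x, 0 ≤ v x) →
    ∀ M : ℝ, (∀ x, u x ≤ M) → (∀ x, v x ≤ M) → ∀ c : ℝ,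
      (∀ x y, u x ^ (1 - s) * v y ^ s ≤ c * Real.exp (s * (1 - s) / 2 * d x y)) →
        (∫ x, u x ∂μ) ^ (1 - s) * (∫ x, v x ∂μ) ^ s ≤ c

theorem integrable_of_nonneg_of_le {E : Type*} [MeasurableSpace E] {μ : Measure E}
    [IsFiniteMeasure μ] {u : E → ℝ} (hu : Measurable u) (h0 : ∀ x, 0 ≤ u x) {M : ℝ}
    (hM : ∀ x, u x ≤ M) : Integrable u μ :=
  Integrable.of_bound hu.aestronglyMeasurable M
    (Filter.Eventually.of_forall fun x => by rw [Real.norm_of_nonneg (h0 x)]; exact hM x)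

theorem MaureyProperty.prod {E E' : Type*} [MeasurableSpace E] [MeasurableSpace E']
    {μ : Measure E} {μ' : Measure E'} [IsProbabilityMeasure μ] [IsProbabilityMeasure μ']
    {d : E → E → ℝ} {d' : E' → E' → ℝ} {s : ℝ} (h : MaureyProperty μ d s)
    (h' : MaureyProperty μ' d' s) :
    MaureyProperty (μ.prod μ') (fun x y => d x.1 y.1 + d' x.2 y.2) s := by
  intro u v hu hv hu0 hv0 M huM hvM c hc
  rw [integral_prod _ (integrable_of_nonneg_of_le hu hu0 huM),
    integral_prod _ (integrable_of_nonneg_of_le hv hv0 hvM)]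
  have le : ∀ u : E × E' → ℝ, Measurable u → (∀ x, 0 ≤ u x) → (∀ x, u x ≤ M) →
      ∀ x, ∫ y, u (x, y) ∂μ' ≤ M := by
    intro u hu hu0 huM x
    calc ∫ y, u (x, y) ∂μ' ≤ ∫ _, M ∂μ' :=
          integral_mono (integrable_of_nonneg_of_le (by fun_prop) (fun _ => hu0 _) fun _ => huM _)
            (integrable_const _) fun _ => huM _
      _ = M := by simp
  refine h _ _ hu.stronglyMeasurable.integral_prod_right'.measurable
    hv.stronglyMeasurable.integral_prod_right'.measurable
    (fun x => integral_nonneg fun _ => hu0 _) (fun x => integral_nonneg fun _ => hv0 _) M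
    (le u hu hu0 huM) (le v hv hv0 hvM) c fun x y => ?_
  refine h' _ _ (by fun_prop) (by fun_prop) (fun _ => hu0 _) (fun _ => hv0 _) M
    (fun _ => huM _) (fun _ => hvM _) _ fun x' y' => ?_
  rw [mul_assoc, ← Real.exp_add, ← mul_add]
  exact hc (x, x') (y, y')

theorem MaureyProperty.of_measurePreserving {E E' : Type*} [MeasurableSpace E] [MeasurableSpace E']
    {μ : Measure E} {μ' : Measure E'} {d' : E' → E' → ℝ} {s : ℝ} (e : E ≃ᵐ E')
    (he : MeasurePreserving e μ μ') (h : MaureyProperty μ' d' s) :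
    MaureyProperty μ (fun x y => d' (e x) (e y)) s := by
  intro u v hu hv hu0 hv0 M huM hvM c hc
  have := h (u ∘ e.symm) (v ∘ e.symm) (by fun_prop) (by fun_prop) (fun _ => hu0 _) (fun _ => hv0 _)
    M (fun _ => huM _) (fun _ => hvM _) c fun x y => by simpa using hc (e.symm x) (e.symm y)
  rw [← he.integral_comp e.measurableEmbedding, ← he.integral_comp e.measurableEmbedding] at this
  simpa using this

theorem maureyProperty_pi {μ : Measure ℝ} [IsProbabilityMeasure μ] {s : ℝ}
    (h : MaureyProperty μ (fun x y => (x - y) ^ 2) s) (n : ℕ) :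
    MaureyProperty (Measure.pi fun _ : Fin n => μ) (fun x y => ∑ i, (x i - y i) ^ 2) s := by
  induction n with
  | zero =>
    intro u v hu hv hu0 hv0 M huM hvM c hc
    have := hc default default
    rw [Measure.pi_of_empty _ default, integral_dirac, integral_dirac]
    simpa using this
  | succ n ih =>
    have := MaureyProperty.of_measurePreserving _
      (measurePreserving_piFinSuccAbove (fun _ : Fin (n + 1) => μ) 0) (h.prod ih)
    convert this using 3 with x y
    simp [Fin.sum_univ_succ, MeasurableEquiv.piFinSuccAbove, Fin.tail]

theorem gaussianPDFReal_convex_combination (s x y : ℝ) :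
    gaussianPDFReal 0 1 x ^ (1 - s) * gaussianPDFReal 0 1 y ^ s *
      Real.exp (s * (1 - s) / 2 * (x - y) ^ 2) =
      gaussianPDFReal 0 1 ((1 - s) * x + s * y) := by
  simp only [gaussianPDFReal]
  have h0 : 0 < (√(2 * Real.pi * ((1 : NNReal) : ℝ)))⁻¹ := by
    simp only [NNReal.coe_one]; positivity
  rw [Real.mul_rpow h0.le (Real.exp_pos _).le, Real.mul_rpow h0.le (Real.exp_pos _).le,
    ← Real.exp_mul, ← Real.exp_mul, mul_mul_mul_comm, ← Real.rpow_add h0, mul_assoc,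
    ← Real.exp_add, ← Real.exp_add]
  simp only [sub_add_cancel, Real.rpow_one]
  congr 2
  simp
  ring

theorem maureyProperty_gaussianReal {s : ℝ} (hs0 : 0 < s) (hs1 : s < 1) :
    MaureyProperty (gaussianReal 0 1) (fun x y => (x - y) ^ 2) s := by
  intro u v hu hv hu0 hv0 M huM hvM c hc
  have hs1' : 0 < 1 - s := by linarith
  have hφ := measurable_gaussianPDFReal 0 1
  have hφ0 := gaussianPDFReal_nonneg 0 1
  have hφi := integrable_gaussianPDFReal 0 1
  have hc0 : 0 ≤ c := by
    refine nonneg_of_mul_nonneg_left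
      ((mul_nonneg (Real.rpow_nonneg (hu0 0) _) (Real.rpow_nonneg (hv0 0) _)).trans (hc 0 0))
      (Real.exp_pos _)
  have hM0 : 0 ≤ M := (hu0 0).trans (huM 0)
  have bdd : ∀ u : ℝ → ℝ, (∀ x, 0 ≤ u x) → (∀ x, u x ≤ M) →
      BddAbove (Set.range fun x => gaussianPDFReal 0 1 x * u x) := by
    intro u hu0 huM
    refine ⟨gaussianPDFReal 0 1 0 * M, ?_⟩
    rintro _ ⟨x, rfl⟩
    refine mul_le_mul ?_ (huM x) (hu0 x) (hφ0 _)
    rw [gaussianPDFReal, gaussianPDFReal]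
    gcongr 1
    simp
    linarith [sq_nonneg x]
  have int : ∀ u : ℝ → ℝ, Measurable u → (∀ x, 0 ≤ u x) → (∀ x, u x ≤ M) →
      Integrable fun x => gaussianPDFReal 0 1 x * u x := fun u hu hu0 huM =>
    hφi.mul_bdd (c := M) hu.aestronglyMeasurable
      (Filter.Eventually.of_forall fun x => by rw [Real.norm_of_nonneg (hu0 x)]; exact huM x)
  have key := prekopa_leindler (hφ.mul hu) (hφ.mul hv) (hφ.mul_const c)
    (fun x => mul_nonneg (hφ0 x) (hu0 x)) (fun x => mul_nonneg (hφ0 x) (hv0 x))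
    (fun x => mul_nonneg (hφ0 x) hc0) (bdd u hu0 huM) (bdd v hv0 hvM)
    (int u hu hu0 huM) (int v hv hv0 hvM) (hφi.mul_const c) hs0 hs1 (fun x y => by
      simp only [Pi.mul_apply]
      rw [Real.mul_rpow (hφ0 x) (hu0 x), Real.mul_rpow (hφ0 y) (hv0 y), mul_mul_mul_comm,
        ← gaussianPDFReal_convex_combination, mul_assoc _ _ c, mul_comm _ c]
      exact mul_le_mul_of_nonneg_left (hc x y)
        (mul_nonneg (Real.rpow_nonneg (hφ0 _) _) (Real.rpow_nonneg (hφ0 _) _)))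
  rw [integral_mul_const, integral_gaussianPDFReal_eq_one 0 one_ne_zero, one_mul] at key
  simpa [integral_gaussianReal_eq_integral_smul] using key

/-- `F` is `L`-Lipschitz with respect to the Euclidean distance. -/
def EuclideanLipschitz {n : ℕ} (L : ℝ) (F : (Fin n → ℝ) → ℝ) : Prop :=
  ∀ x y, |F x - F y| ≤ L * √(∑ i, (x i - y i) ^ 2)

theorem EuclideanLipschitz.continuous {n : ℕ} {L : ℝ} {F : (Fin n → ℝ) → ℝ}
    (hF : EuclideanLipschitz L F) : Continuous F := by
  rw [continuous_iff_continuousAt]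
  intro x
  rw [ContinuousAt, tendsto_iff_dist_tendsto_zero]
  refine squeeze_zero (fun _ => dist_nonneg) (fun y => hF y x) ?_
  have : Continuous fun y : Fin n → ℝ => L * √(∑ i, (y i - x i) ^ 2) := by fun_prop
  simpa using this.tendsto x

theorem EuclideanLipschitz.integrable {n : ℕ} {L : ℝ} (hL : 0 ≤ L) {F : (Fin n → ℝ) → ℝ}
    (hF : EuclideanLipschitz L F) :
    Integrable F (Measure.pi fun _ : Fin n => gaussianReal 0 1) := by
  have hg : Integrable (fun x : ℝ => x) (gaussianReal 0 1) :=
    (memLp_id_gaussianReal (μ := 0) (v := 1) 1).integrable (by simp)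
  have hi : ∀ i : Fin n, Integrable (fun x : Fin n → ℝ => x i)
      (Measure.pi fun _ : Fin n => gaussianReal 0 1) := fun i =>
    (measurePreserving_eval (fun _ : Fin n => gaussianReal 0 1) i).integrable_comp_of_integrable hg
  refine Integrable.mono' (g := fun x => |F 0| + L * ∑ i, |x i|)
    ((integrable_const _).add ((integrable_finsetSum _ fun i _ => (hi i).abs).const_mul L))
    hF.continuous.aestronglyMeasurable (Filter.Eventually.of_forall fun x => ?_)
  have h1 := hF x 0
  have h2 : √(∑ i, (x i - (0 : Fin n → ℝ) i) ^ 2) ≤ ∑ i, |x i| := by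
    rw [Real.sqrt_le_left (Finset.sum_nonneg fun _ _ => abs_nonneg _)]
    simpa using Finset.sum_sq_le_sq_sum_of_nonneg (s := Finset.univ) (f := fun i => |x i|)
      fun _ _ => abs_nonneg _
  have h3 := abs_sub_abs_le_abs_sub (F x) (F 0)
  have h4 := mul_le_mul_of_nonneg_left h2 hL
  rw [Real.norm_eq_abs]
  linarith

theorem EuclideanLipschitz.const_mul {n : ℕ} {L : ℝ} {F : (Fin n → ℝ) → ℝ}
    (hF : EuclideanLipschitz L F) (r : ℝ) : EuclideanLipschitz (|r| * L) fun x => r * F x := by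
  intro x y
  rw [← mul_sub, abs_mul, mul_assoc]
  exact mul_le_mul_of_nonneg_left (hF x y) (abs_nonneg r)

theorem EuclideanLipschitz.max_min {n : ℕ} {L : ℝ} {F : (Fin n → ℝ) → ℝ}
    (hF : EuclideanLipschitz L F) (a b : ℝ) :
    EuclideanLipschitz L fun x => max a (min (F x) b) := by
  intro x y
  refine le_trans ?_ (hF x y)
  simp only [max_comm a]
  refine (abs_max_sub_max_le_abs _ _ _).trans ?_
  simpa using abs_min_sub_min_le_max (F x) b (F y) b

theorem EuclideanLipschitz.integral_exp_le_of_bounded {n : ℕ} {L : ℝ}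
    {F : (Fin n → ℝ) → ℝ} (hF : EuclideanLipschitz L F) {M : ℝ} (hM : ∀ x, |F x| ≤ M) :
    ∫ x, Real.exp (F x) ∂(Measure.pi fun _ : Fin n => gaussianReal 0 1) ≤
      Real.exp (∫ x, F x ∂(Measure.pi fun _ : Fin n => gaussianReal 0 1) + L ^ 2 / 2) := by
  set γ := Measure.pi fun _ : Fin n => gaussianReal 0 1
  have hFm : Measurable F := hF.continuous.measurable
  have hM0 : 0 ≤ M := (abs_nonneg _).trans (hM 0)
  have hFi : Integrable F γ := Integrable.of_bound hFm.aestronglyMeasurable M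
    (Filter.Eventually.of_forall hM)
  have exp_bd : ∀ r x, Real.exp (r * F x) ≤ Real.exp (|r| * M) := fun r x => by
    refine Real.exp_le_exp.2 ((le_abs_self _).trans ?_)
    rw [abs_mul]
    exact mul_le_mul_of_nonneg_left (hM x) (abs_nonneg r)
  have exp_int : ∀ r, Integrable (fun x => Real.exp (r * F x)) γ := fun r =>
    integrable_of_nonneg_of_le (by fun_prop) (fun _ => (Real.exp_pos _).le) (exp_bd r)
  have key : ∀ s : ℝ, 0 < s → s < 1 →
      ∫ x, Real.exp (F x) ∂γ ≤ Real.exp (∫ x, F x ∂γ + L ^ 2 / (2 * (1 - s))) := by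
    intro s hs0 hs1
    have hs1' : 0 < 1 - s := by linarith
    have h := maureyProperty_pi (maureyProperty_gaussianReal hs0 hs1) n
      (fun x => Real.exp (-(s / (1 - s)) * F x)) (fun x => Real.exp (1 * F x))
      (by fun_prop) (by fun_prop) (fun _ => (Real.exp_pos _).le) (fun _ => (Real.exp_pos _).le)
      (max (Real.exp (|-(s / (1 - s))| * M)) (Real.exp (|1| * M)))
      (fun x => (exp_bd _ x).trans (le_max_left _ _))
      (fun x => (exp_bd _ x).trans (le_max_right _ _))
      (Real.exp (s * (L ^ 2 / (2 * (1 - s))))) (fun x y => by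
        rw [← Real.exp_mul, ← Real.exp_mul, ← Real.exp_add, ← Real.exp_add, Real.exp_le_exp]
        have e1 : -(s / (1 - s)) * F x * (1 - s) = -s * F x := by field_simp
        rw [e1]
        have hd : 0 ≤ ∑ i, (x i - y i) ^ 2 := Finset.sum_nonneg fun _ _ => sq_nonneg _
        have h1 := (abs_sub_le_iff.1 (hF x y)).2
        set d := ∑ i, (x i - y i) ^ 2
        have h2 : L * √d ≤ L ^ 2 / (2 * (1 - s)) + (1 - s) / 2 * d := by
          have e2 : L ^ 2 / (2 * (1 - s)) + (1 - s) / 2 * d - L * √d =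
              (L - (1 - s) * √d) ^ 2 / (2 * (1 - s)) := by
            rw [sub_sq, mul_pow, Real.sq_sqrt hd]
            field_simp
            ring
          have : 0 ≤ (L - (1 - s) * √d) ^ 2 / (2 * (1 - s)) := by positivity
          linarith
        have h3 := mul_le_mul_of_nonneg_left (h1.trans h2) hs0.le
        linarith)
    have jensen : Real.exp (∫ x, -(s / (1 - s)) * F x ∂γ) ≤
        ∫ x, Real.exp (-(s / (1 - s)) * F x) ∂γ :=
      convexOn_exp.map_integral_le Real.continuous_exp.continuousOn isClosed_univ
        (Filter.Eventually.of_forall fun _ => Set.mem_univ _) (hFi.const_mul _) (exp_int _)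
    have hv0 : 0 ≤ ∫ x, Real.exp (1 * F x) ∂γ := integral_nonneg fun _ => (Real.exp_pos _).le
    have h' := (mul_le_mul_of_nonneg_right
      (Real.rpow_le_rpow (Real.exp_pos _).le jensen hs1'.le) (Real.rpow_nonneg hv0 s)).trans h
    rw [integral_const_mul, ← Real.exp_mul] at h'
    have e1 : -(s / (1 - s)) * (∫ x, F x ∂γ) * (1 - s) = -(s * ∫ x, F x ∂γ) := by field_simp
    rw [e1, Real.exp_neg, inv_mul_le_iff₀ (Real.exp_pos _), ← Real.exp_add, ← mul_add,
      mul_comm s, Real.exp_mul, Real.rpow_le_rpow_iff hv0 (Real.exp_pos _).le hs0] at h'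
    simpa using h'
  have lim : Filter.Tendsto (fun s : ℝ => Real.exp (∫ x, F x ∂γ + L ^ 2 / (2 * (1 - s))))
      (nhdsWithin 0 (Set.Ioi 0)) (nhds (Real.exp (∫ x, F x ∂γ + L ^ 2 / 2))) := by
    have : ContinuousAt (fun s : ℝ => Real.exp (∫ x, F x ∂γ + L ^ 2 / (2 * (1 - s)))) 0 := by
      have : (2 * (1 - 0) : ℝ) ≠ 0 := by norm_num
      fun_prop (disch := assumption)
    simpa [ContinuousAt] using this.tendsto.mono_left nhdsWithin_le_nhds
  refine ge_of_tendsto lim ?_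
  filter_upwards [Ioo_mem_nhdsGT (show (0 : ℝ) < 1 by norm_num)] with s hs using key s hs.1 hs.2

theorem EuclideanLipschitz.lintegral_exp_le {n : ℕ} {L : ℝ} (hL : 0 ≤ L)
    {F : (Fin n → ℝ) → ℝ} (hF : EuclideanLipschitz L F) :
    ∫⁻ x, ENNReal.ofReal (Real.exp (F x)) ∂(Measure.pi fun _ : Fin n => gaussianReal 0 1) ≤
      ENNReal.ofReal
        (Real.exp (∫ x, F x ∂(Measure.pi fun _ : Fin n => gaussianReal 0 1) + L ^ 2 / 2)) := by
  set γ := Measure.pi fun _ : Fin n => gaussianReal 0 1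
  set G : ℕ → (Fin n → ℝ) → ℝ := fun j x => max (-(j : ℝ)) (min (F x) j) with hG
  have hGL : ∀ j, EuclideanLipschitz L (G j) := fun j => hF.max_min _ _
  have hGb : ∀ j x, |G j x| ≤ j := fun j x => by
    rw [abs_le]
    exact ⟨le_max_left _ _, max_le (by linarith [Nat.cast_nonneg (α := ℝ) j]) (min_le_right _ _)⟩
  have hGF : ∀ j x, |G j x| ≤ |F x| := fun j x => by
    have hj := Nat.cast_nonneg (α := ℝ) j
    rw [abs_le]
    constructor
    · refine le_max_of_le_right (le_min (neg_abs_le _) ?_)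
      linarith [abs_nonneg (F x)]
    · exact max_le (by linarith [abs_nonneg (F x)]) (min_le_of_left_le (le_abs_self _))
  have hGt : ∀ x, Filter.Tendsto (fun j => G j x) Filter.atTop (nhds (F x)) := fun x => by
    refine tendsto_const_nhds.congr' ?_
    filter_upwards [Filter.eventually_ge_atTop ⌈|F x|⌉₊] with j hj
    have h1 := abs_le.1 (Nat.ceil_le.1 hj)
    simp only [hG]
    rw [min_eq_left h1.2, max_eq_right h1.1]
  have hlim : Filter.Tendsto (fun j => ∫ x, G j x ∂γ) Filter.atTop (nhds (∫ x, F x ∂γ)) :=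
    tendsto_integral_of_dominated_convergence (fun x => |F x|)
      (fun j => (hGL j).continuous.aestronglyMeasurable) (hF.integrable hL).abs
      (fun j => Filter.Eventually.of_forall (hGF j)) (Filter.Eventually.of_forall hGt)
  have hlim' : Filter.Tendsto
      (fun j => ENNReal.ofReal (Real.exp (∫ x, G j x ∂γ + L ^ 2 / 2))) Filter.atTop
      (nhds (ENNReal.ofReal (Real.exp (∫ x, F x ∂γ + L ^ 2 / 2)))) :=
    (ENNReal.continuous_ofReal.tendsto _).comp
      ((Real.continuous_exp.tendsto _).comp (hlim.add_const _))
  have hb : ∀ j, ∫⁻ x, ENNReal.ofReal (Real.exp (G j x)) ∂γ ≤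
      ENNReal.ofReal (Real.exp (∫ x, G j x ∂γ + L ^ 2 / 2)) := fun j => by
    have hm : Measurable (G j) := (hGL j).continuous.measurable
    rw [← ofReal_integral_eq_lintegral_ofReal]
    · exact ENNReal.ofReal_le_ofReal ((hGL j).integral_exp_le_of_bounded (hGb j))
    · exact integrable_of_nonneg_of_le (by fun_prop) (fun _ => (Real.exp_pos _).le)
        fun x => Real.exp_le_exp.2 ((le_abs_self _).trans (hGb j x))
    · exact Filter.Eventually.of_forall fun _ => (Real.exp_pos _).le
  calc ∫⁻ x, ENNReal.ofReal (Real.exp (F x)) ∂γ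
      = ∫⁻ x, Filter.liminf (fun j => ENNReal.ofReal (Real.exp (G j x))) Filter.atTop ∂γ := by
        refine lintegral_congr fun x => ?_
        exact (((ENNReal.continuous_ofReal.comp Real.continuous_exp).tendsto _).comp
          (hGt x)).liminf_eq.symm
    _ ≤ Filter.liminf (fun j => ∫⁻ x, ENNReal.ofReal (Real.exp (G j x)) ∂γ) Filter.atTop := by
        refine lintegral_liminf_le fun j => ?_
        have hm : Measurable (G j) := (hGL j).continuous.measurable
        fun_prop
    _ ≤ Filter.liminf (fun j => ENNReal.ofReal (Real.exp (∫ x, G j x ∂γ + L ^ 2 / 2)))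
          Filter.atTop := Filter.liminf_le_liminf (Filter.Eventually.of_forall hb)
    _ = _ := hlim'.liminf_eq

/-- Gaussian concentration: a Lipschitz function of a standard Gaussian vector is sub-Gaussian
with the optimal variance proxy. -/
theorem EuclideanLipschitz.hasSubgaussianMGF {n : ℕ} {L : NNReal}
    {F : (Fin n → ℝ) → ℝ} (hF : EuclideanLipschitz L F) :
    HasSubgaussianMGF
      (fun x => F x - ∫ y, F y ∂(Measure.pi fun _ : Fin n => gaussianReal 0 1)) (L ^ 2)
      (Measure.pi fun _ : Fin n => gaussianReal 0 1) := by
  set γ := Measure.pi fun _ : Fin n => gaussianReal 0 1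
  set m := ∫ y, F y ∂γ
  have hFm : Measurable F := hF.continuous.measurable
  have h : ∀ t, ∫⁻ x, ENNReal.ofReal (Real.exp (t * (F x - m))) ∂γ ≤
      ENNReal.ofReal (Real.exp ((L : ℝ) ^ 2 * t ^ 2 / 2)) := fun t => by
    have h1 := (hF.const_mul t).lintegral_exp_le (by positivity)
    rw [integral_const_mul, Real.exp_add, ENNReal.ofReal_mul (Real.exp_pos _).le] at h1
    calc ∫⁻ x, ENNReal.ofReal (Real.exp (t * (F x - m))) ∂γ
        = ENNReal.ofReal (Real.exp (-(t * m))) *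
          ∫⁻ x, ENNReal.ofReal (Real.exp (t * F x)) ∂γ := by
          rw [← lintegral_const_mul _ (by fun_prop)]
          refine lintegral_congr fun x => ?_
          rw [← ENNReal.ofReal_mul (Real.exp_pos _).le, ← Real.exp_add]
          ring_nf
      _ ≤ ENNReal.ofReal (Real.exp (-(t * m))) * (ENNReal.ofReal (Real.exp (t * m)) *
          ENNReal.ofReal (Real.exp ((|t| * L) ^ 2 / 2))) := by gcongr
      _ = _ := by
          rw [← mul_assoc, ← ENNReal.ofReal_mul (Real.exp_pos _).le, ← Real.exp_add,
            mul_pow, sq_abs]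
          simp [mul_comm]
  have hInt : ∀ t, Integrable (fun x => Real.exp (t * (F x - m))) γ := fun t => by
    refine ⟨by fun_prop, ?_⟩
    rw [hasFiniteIntegral_iff_ofReal (Filter.Eventually.of_forall fun _ => (Real.exp_pos _).le)]
    exact (h t).trans_lt ENNReal.ofReal_lt_top
  refine ⟨hInt, fun t => ?_⟩
  have h1 := h t
  rw [← ofReal_integral_eq_lintegral_ofReal (hInt t)
    (Filter.Eventually.of_forall fun _ => (Real.exp_pos _).le),
    ENNReal.ofReal_le_ofReal_iff (Real.exp_pos _).le] at h1
  simpa [mgf] using h1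

theorem HasSubgaussianMGF.integral_sq_le {Ω : Type*} [MeasurableSpace Ω] {μ : Measure Ω}
    {X : Ω → ℝ} {c : NNReal} (hc : 0 < c) (h : HasSubgaussianMGF X c μ) :
    ∫ ω, X ω ^ 2 ∂μ ≤ 8 * c := by
  have hc' : (0 : ℝ) < c := hc
  set r := (√(c : ℝ))⁻¹ with hr
  have hr2 : r ^ 2 = (c : ℝ)⁻¹ := by rw [hr, inv_pow, Real.sq_sqrt hc'.le]
  have hm : ∀ t, t ^ 2 = r ^ 2 → ∫ ω, Real.exp (t * X ω) ∂μ ≤ 2 := fun t ht => by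
    refine (h.mgf_le t).trans ?_
    rw [ht, hr2, mul_inv_cancel₀ hc'.ne']
    have h1 := Real.exp_one_lt_d9
    have h2 : Real.exp (1 / 2) ^ 2 = Real.exp 1 := by rw [← Real.exp_nat_mul]; norm_num
    nlinarith [Real.exp_pos (1 / 2)]
  have hpt : ∀ ω, X ω ^ 2 ≤ 2 * c * (Real.exp (r * X ω) + Real.exp (-r * X ω)) := fun ω => by
    have h1 : ∀ x : ℝ, x ^ 2 ≤ 2 * (Real.exp x + Real.exp (-x)) := by
      intro x
      have h2 := Real.quadratic_le_exp_of_nonneg (abs_nonneg x)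
      rw [sq_abs] at h2
      have h3 : Real.exp |x| ≤ Real.exp x + Real.exp (-x) := by
        rcases abs_cases x with ⟨h, _⟩ | ⟨h, _⟩ <;> rw [h] <;>
          linarith [Real.exp_pos x, Real.exp_pos (-x)]
      linarith [abs_nonneg x]
    have h2 := mul_le_mul_of_nonneg_left (h1 (r * X ω)) hc'.le
    rw [mul_pow, hr2, ← mul_assoc, mul_inv_cancel₀ hc'.ne', one_mul] at h2
    rw [neg_mul]
    linarith
  calc ∫ ω, X ω ^ 2 ∂μ ≤ ∫ ω, 2 * c * (Real.exp (r * X ω) + Real.exp (-r * X ω)) ∂μ :=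
        integral_mono (h.memLp 2).integrable_sq
          (((h.integrable_exp_mul _).add (h.integrable_exp_mul _)).const_mul _) hpt
    _ = 2 * c * (∫ ω, Real.exp (r * X ω) ∂μ + ∫ ω, Real.exp (-r * X ω) ∂μ) := by
        rw [integral_const_mul, integral_add (h.integrable_exp_mul _) (h.integrable_exp_mul _)]
    _ ≤ 2 * c * (2 + 2) := by
        gcongr
        · exact hm r rfl
        · exact hm (-r) (by ring)
    _ = 8 * c := by ring

/-- Two-sided Gaussian concentration inequality. -/
theorem EuclideanLipschitz.measure_abs_sub_gt_le {n : ℕ} {L : NNReal} {F : (Fin n → ℝ) → ℝ}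
    (hF : EuclideanLipschitz L F) {ε : ℝ} (hε : 0 ≤ ε) :
    (Measure.pi fun _ : Fin n => gaussianReal 0 1)
      {x | ε < |F x - ∫ y, F y ∂(Measure.pi fun _ : Fin n => gaussianReal 0 1)|} ≤
      ENNReal.ofReal (2 * Real.exp (-ε ^ 2 / (2 * (L : ℝ) ^ 2))) := by
  set γ := Measure.pi fun _ : Fin n => gaussianReal 0 1
  set m := ∫ y, F y ∂γ
  have h := hF.hasSubgaussianMGF
  have h1 := h.measure_ge_le hε
  have h2 := h.neg.measure_ge_le hε
  rw [two_mul, ENNReal.ofReal_add (Real.exp_pos _).le (Real.exp_pos _).le]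
  have conv : ∀ s : Set (Fin n → ℝ), γ.real s ≤ Real.exp (-ε ^ 2 / (2 * (L ^ 2 : NNReal))) →
      γ s ≤ ENNReal.ofReal (Real.exp (-ε ^ 2 / (2 * (L : ℝ) ^ 2))) := fun s hs => by
    rw [← ofReal_measureReal]
    exact ENNReal.ofReal_le_ofReal (by simpa using hs)
  refine le_trans (measure_mono ?_) ((measure_union_le _ _).trans (add_le_add (conv _ h1) (conv _ h2)))
  intro x (hx : ε < |F x - m|)
  rcases lt_abs.1 hx with hx | hx
  · exact Or.inl hx.le
  · exact Or.inr hx.le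

theorem sum_le_topSum {n k : ℕ} (Y : Fin n → ℝ) {S : Finset (Fin n)} (hS : S.card = k) :
    ∑ i ∈ S, Y i ≤ topSum n k Y :=
  le_csSup (Set.toFinite _).bddAbove ⟨S, hS, rfl⟩

theorem exists_topSum_eq {n k : ℕ} (hk : k ≤ n) (Y : Fin n → ℝ) :
    ∃ S : Finset (Fin n), S.card = k ∧ topSum n k Y = ∑ i ∈ S, Y i := by
  obtain ⟨S, -, hS⟩ := Finset.exists_subset_card_eq (s := (Finset.univ : Finset (Fin n))) (n := k)
    (by simpa using hk)
  obtain ⟨S', h1, h2⟩ := Set.Nonempty.csSup_mem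
    (s := (fun S : Finset (Fin n) => ∑ i ∈ S, Y i) '' {S | S.card = k})
    ⟨_, S, hS, rfl⟩ (Set.toFinite _)
  exact ⟨S', h1, h2.symm⟩

theorem measurable_topSum (n k : ℕ) : Measurable (topSum n k) := by
  have : topSum n k = fun Y => ⨆ S : {S : Finset (Fin n) | S.card = k}, ∑ i ∈ S.1, Y i := by
    ext Y
    rw [topSum, sSup_image']
  rw [this]
  exact Measurable.iSup fun S => by fun_prop

theorem topSum_le_add_sum_max {n k : ℕ} (hk : k ≤ n) (Y : Fin n → ℝ) (t : ℝ) :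
    topSum n k Y ≤ k * t + ∑ i, max (Y i - t) 0 := by
  obtain ⟨S, hS, h⟩ := exists_topSum_eq hk Y
  rw [h]
  calc ∑ i ∈ S, Y i ≤ ∑ i ∈ S, (t + max (Y i - t) 0) :=
        Finset.sum_le_sum fun i _ => by linarith [le_max_left (Y i - t) 0]
    _ = k * t + ∑ i ∈ S, max (Y i - t) 0 := by simp [Finset.sum_add_distrib, hS]
    _ ≤ _ := by
        gcongr
        exact Finset.subset_univ S

theorem sqrt_sum_sq_le_add {ι : Type*} (S : Finset ι) (x y : ι → ℝ) :
    √(∑ i ∈ S, x i ^ 2) ≤ √(∑ i ∈ S, y i ^ 2) + √(∑ i ∈ S, (x i - y i) ^ 2) := by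
  rw [Real.sqrt_le_left (by positivity), add_sq,
    Real.sq_sqrt (Finset.sum_nonneg fun _ _ => sq_nonneg _),
    Real.sq_sqrt (Finset.sum_nonneg fun _ _ => sq_nonneg _)]
  have h := Real.sum_mul_le_sqrt_mul_sqrt S y fun i => x i - y i
  have e : ∑ i ∈ S, x i ^ 2 =
      ∑ i ∈ S, y i ^ 2 + 2 * ∑ i ∈ S, y i * (x i - y i) + ∑ i ∈ S, (x i - y i) ^ 2 := by
    rw [Finset.mul_sum, ← Finset.sum_add_distrib, ← Finset.sum_add_distrib]
    exact Finset.sum_congr rfl fun i _ => by ring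
  linarith

theorem euclideanLipschitz_sqrt_topSum {n k : ℕ} (hk : k ≤ n) :
    EuclideanLipschitz (√(k : ℝ))⁻¹ fun x : Fin n → ℝ => √(topSum n k (fun i => x i ^ 2) / k) := by
  have le : ∀ x y : Fin n → ℝ, √(topSum n k fun i => x i ^ 2) ≤
      √(topSum n k fun i => y i ^ 2) + √(∑ i, (x i - y i) ^ 2) := fun x y => by
    obtain ⟨S, hS, h⟩ := exists_topSum_eq hk fun i => x i ^ 2
    rw [h]
    refine (sqrt_sum_sq_le_add S x y).trans (add_le_add ?_ ?_)
    · exact Real.sqrt_le_sqrt (sum_le_topSum (fun i => y i ^ 2) hS)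
    · exact Real.sqrt_le_sqrt (Finset.sum_le_sum_of_subset_of_nonneg (Finset.subset_univ S)
        fun _ _ _ => sq_nonneg _)
  intro x y
  simp only [Real.sqrt_div' _ (Nat.cast_nonneg k)]
  rw [← sub_div, abs_div, abs_of_nonneg (Real.sqrt_nonneg (k : ℝ)), div_eq_inv_mul]
  refine mul_le_mul_of_nonneg_left ?_ (by positivity)
  have h1 := le x y
  have h2 := le y x
  have e : ∑ i, (y i - x i) ^ 2 = ∑ i, (x i - y i) ^ 2 :=
    Finset.sum_congr rfl fun i _ => by ring
  rw [e] at h2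
  rw [abs_le]
  constructor <;> linarith

/-- The number of entries of `Y` exceeding `u`. -/
noncomputable def countGt {n : ℕ} (Y : Fin n → ℝ) (u : ℝ) : ℝ :=
  ∑ i, if u < Y i then 1 else 0

/-- A `k`-subset attaining `topSum` contains `min k N` of the `N` entries exceeding any level. -/
theorem min_countGt_le {n k : ℕ} {Y : Fin n → ℝ} {S : Finset (Fin n)} (hS : S.card = k)
    (h : topSum n k Y = ∑ i ∈ S, Y i) (u : ℝ) :
    min (k : ℝ) (countGt Y u) ≤ ∑ i ∈ S, if u < Y i then 1 else 0 := by
  by_cases hall : ∀ i ∈ S, u < Y i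
  · refine (min_le_left _ _).trans ?_
    rw [Finset.sum_congr rfl fun i hi => if_pos (hall i hi)]
    simp [hS]
  · push Not at hall
    obtain ⟨i, hi, hiu⟩ := hall
    refine (min_le_right _ _).trans (le_of_eq ?_)
    refine (Finset.sum_subset (Finset.subset_univ S) fun j _ hj => if_neg ?_).symm
    have hij : ∑ l ∈ insert j (S.erase i), Y l ≤ ∑ l ∈ S, Y l := by
      rw [← h]
      apply sum_le_topSum
      rw [Finset.card_insert_of_notMem fun hmem => hj (Finset.mem_of_mem_erase hmem),
        Finset.card_erase_add_one hi, hS]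
    rw [Finset.sum_insert fun hmem => hj (Finset.mem_of_mem_erase hmem),
      ← Finset.add_sum_erase _ _ hi] at hij
    linarith

/-- The discrepancy between the number of entries above level `u` and its target `k`, on the side
of `t` relevant for `topSum`. -/
noncomputable def discrepancy {n : ℕ} (k : ℕ) (t : ℝ) (Y : Fin n → ℝ) (u : ℝ) : ℝ :=
  if u ≤ t then max (k - countGt Y u) 0 else max (countGt Y u - k) 0

theorem lintegral_ite_lt_const {y : ℝ} :
    ∫⁻ u in Set.Ioi 0, ENNReal.ofReal (if u < y then 1 else 0) = ENNReal.ofReal y := by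
  have : ∀ u : ℝ, ENNReal.ofReal (if u < y then 1 else 0) = (Set.Iio y).indicator 1 u := by
    intro u
    by_cases h : u < y <;> simp [h]
  simp_rw [this]
  rw [lintegral_indicator_one measurableSet_Iio, Measure.restrict_apply measurableSet_Iio,
    Set.Iio_inter_Ioi, Real.volume_Ioo, sub_zero]

theorem lintegral_ite_Ioo {t y : ℝ} (ht : 0 ≤ t) :
    ∫⁻ u in Set.Ioi 0, ENNReal.ofReal (if u ≤ t then 0 else if u < y then 1 else 0) =
      ENNReal.ofReal (max (y - t) 0) := by
  have : ∀ u : ℝ, ENNReal.ofReal (if u ≤ t then 0 else if u < y then 1 else 0) =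
      (Set.Ioo t y).indicator 1 u := by
    intro u
    by_cases h : u ≤ t
    · simp [h, not_lt.2 h]
    · by_cases h' : u < y <;> simp [h, h', not_le.1 h]
  simp_rw [this]
  rw [lintegral_indicator_one measurableSet_Ioo, Measure.restrict_apply measurableSet_Ioo,
    Set.inter_eq_left.2 (show Set.Ioo t y ⊆ Set.Ioi 0 from fun u hu => ht.trans_lt hu.1), Real.volume_Ioo]
  simp

theorem lintegral_ite_le_const {t : ℝ} :
    ∫⁻ u in Set.Ioi 0, ENNReal.ofReal (if u ≤ t then 1 else 0) = ENNReal.ofReal t := by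
  have : ∀ u : ℝ, ENNReal.ofReal (if u ≤ t then 1 else 0) = (Set.Iic t).indicator 1 u := by
    intro u
    by_cases h : u ≤ t <;> simp [h]
  simp_rw [this]
  rw [lintegral_indicator_one measurableSet_Iic, Measure.restrict_apply measurableSet_Iic,
    Set.Iic_inter_Ioi, Real.volume_Ioc, sub_zero]

theorem add_sum_max_le_topSum_add {n k : ℕ} (hk : k ≤ n) {Y : Fin n → ℝ} (hY : ∀ i, 0 ≤ Y i)
    {t : ℝ} (ht : 0 ≤ t) :
    ENNReal.ofReal (k * t + ∑ i, max (Y i - t) 0) ≤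
      ENNReal.ofReal (topSum n k Y) +
        ∫⁻ u in Set.Ioi 0, ENNReal.ofReal (discrepancy k t Y u) := by
  obtain ⟨S, hS, h⟩ := exists_topSum_eq hk Y
  have m1 : ∀ y : ℝ, Measurable fun u : ℝ => ENNReal.ofReal (if u < y then 1 else 0) := fun y =>
    (Measurable.ite measurableSet_Iio measurable_const measurable_const).ennreal_ofReal
  have m2 : Measurable fun u : ℝ => ENNReal.ofReal (if u ≤ t then 1 else 0) :=
    (Measurable.ite measurableSet_Iic measurable_const measurable_const).ennreal_ofReal
  have m3 : ∀ y : ℝ, Measurable fun u : ℝ =>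
      ENNReal.ofReal (if u ≤ t then 0 else if u < y then 1 else 0) := fun y =>
    (Measurable.ite measurableSet_Iic measurable_const
      (Measurable.ite measurableSet_Iio measurable_const measurable_const)).ennreal_ofReal
  have e1 : ENNReal.ofReal (k * t + ∑ i, max (Y i - t) 0) =
      ∫⁻ u in Set.Ioi 0, (ENNReal.ofReal k * ENNReal.ofReal (if u ≤ t then 1 else 0) +
        ∑ i, ENNReal.ofReal (if u ≤ t then 0 else if u < Y i then 1 else 0)) := by
    rw [lintegral_add_left (m2.const_mul _), lintegral_const_mul _ m2,
      lintegral_finsetSum _ fun i _ => m3 _, lintegral_ite_le_const,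
      ENNReal.ofReal_add (by positivity) (Finset.sum_nonneg fun _ _ => le_max_right _ _),
      ENNReal.ofReal_mul (Nat.cast_nonneg k),
      ENNReal.ofReal_sum_of_nonneg fun _ _ => le_max_right _ _]
    simp_rw [lintegral_ite_Ioo ht]
  have e2 : ENNReal.ofReal (topSum n k Y) =
      ∫⁻ u in Set.Ioi 0, ∑ i ∈ S, ENNReal.ofReal (if u < Y i then 1 else 0) := by
    rw [lintegral_finsetSum _ fun i _ => m1 _, h, ENNReal.ofReal_sum_of_nonneg fun i _ => hY i]
    simp_rw [lintegral_ite_lt_const]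
  rw [e1, e2, ← lintegral_add_left (Finset.measurable_sum _ fun i _ => m1 _)]
  refine lintegral_mono fun u => ?_
  have nn : ∀ p : Prop, ∀ [Decidable p], (0 : ℝ) ≤ if p then 1 else 0 := by
    intro p _
    split_ifs <;> norm_num
  have nn' : ∀ i, (0 : ℝ) ≤ if u ≤ t then 0 else if u < Y i then 1 else 0 := fun i => by
    split_ifs <;> norm_num
  rw [← ENNReal.ofReal_mul (Nat.cast_nonneg k), ← ENNReal.ofReal_sum_of_nonneg fun i _ => nn' i,
    ← ENNReal.ofReal_sum_of_nonneg fun i _ => nn _,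
    ← ENNReal.ofReal_add (mul_nonneg (Nat.cast_nonneg k) (nn _))
      (Finset.sum_nonneg fun i _ => nn' i)]
  refine le_trans (ENNReal.ofReal_le_ofReal ?_) ENNReal.ofReal_add_le
  have hm := min_countGt_le hS h u
  by_cases hu : u ≤ t
  · simp only [hu, if_true, discrepancy, Finset.sum_const_zero]
    rcases min_choice (k : ℝ) (countGt Y u) with h | h <;> rw [h] at hm <;>
      linarith [le_max_left ((k : ℝ) - countGt Y u) 0, le_max_right ((k : ℝ) - countGt Y u) 0]
  · simp only [hu, if_false, discrepancy]
    rw [← countGt]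
    rcases min_choice (k : ℝ) (countGt Y u) with h | h <;> rw [h] at hm <;>
      linarith [le_max_left (countGt Y u - (k : ℝ)) 0, le_max_right (countGt Y u - (k : ℝ)) 0]

instance isProbabilityMeasure_chiSq1 : IsProbabilityMeasure chiSq1 :=
  Measure.isProbabilityMeasure_map (by fun_prop)

theorem chiSq1_Ioi (u : ℝ) : chiSq1 (Set.Ioi u) = gaussianReal 0 1 {x | u < x ^ 2} := by
  rw [chiSq1, Measure.map_apply (by fun_prop) measurableSet_Ioi]
  rfl

theorem chiSq1_Ioi_of_neg {u : ℝ} (hu : u < 0) : chiSq1 (Set.Ioi u) = 1 := by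
  rw [chiSq1_Ioi, show {x : ℝ | u < x ^ 2} = Set.univ from
    Set.eq_univ_of_forall fun x => hu.trans_le (sq_nonneg x), measure_univ]

theorem gaussianReal_Iio_neg (r : ℝ) :
    gaussianReal 0 1 (Set.Iio (-r)) = gaussianReal 0 1 (Set.Ioi r) := by
  have h : (gaussianReal 0 1).map (fun x => -x) = gaussianReal 0 1 := by
    simpa using gaussianReal_map_neg (μ := 0) (v := 1)
  conv_rhs => rw [← h, Measure.map_apply (by fun_prop) measurableSet_Ioi]
  congr 1
  ext x
  simp

theorem chiSq1_Ioi_of_nonneg {u : ℝ} (hu : 0 ≤ u) :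
    chiSq1 (Set.Ioi u) = 2 * gaussianReal 0 1 (Set.Ioi √u) := by
  have h : {x : ℝ | u < x ^ 2} = Set.Ioi √u ∪ Set.Iio (-√u) := by
    ext x
    simp only [Set.mem_ofPred_eq, Set.mem_union, Set.mem_Ioi, Set.mem_Iio]
    rw [← Real.sqrt_lt_sqrt_iff hu, Real.sqrt_sq_eq_abs, lt_abs, lt_neg]
  rw [chiSq1_Ioi, h, measure_union _ measurableSet_Iio, gaussianReal_Iio_neg, two_mul]
  rw [Set.disjoint_left]
  intro x hx hx'
  have h1 : √u < x := hx
  have h2 : x < -√u := hx'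
  linarith [Real.sqrt_nonneg u]

theorem gaussianReal_Ioi_le {r s : ℝ} (hrs : r ≤ s) :
    gaussianReal 0 1 (Set.Ioi s) ≤
      ENNReal.ofReal (Real.exp (-(s ^ 2 - r ^ 2) / 2)) * gaussianReal 0 1 (Set.Ioi r) := by
  rw [gaussianReal_apply 0 one_ne_zero, gaussianReal_apply 0 one_ne_zero,
    ← lintegral_indicator measurableSet_Ioi, ← lintegral_indicator measurableSet_Ioi,
    ← lintegral_add_right_eq_self _ (s - r),
    ← lintegral_const_mul _ ((measurable_gaussianPDF 0 1).indicator measurableSet_Ioi)]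
  refine lintegral_mono fun x => ?_
  by_cases hx : r < x
  · rw [Set.indicator_of_mem (show x + (s - r) ∈ Set.Ioi s by simp only [Set.mem_Ioi]; linarith),
      Set.indicator_of_mem (show x ∈ Set.Ioi r from hx), gaussianPDF, gaussianPDF,
      ← ENNReal.ofReal_mul (Real.exp_pos _).le]
    refine ENNReal.ofReal_le_ofReal ?_
    rw [gaussianPDFReal, gaussianPDFReal, mul_left_comm, ← Real.exp_add]
    refine mul_le_mul_of_nonneg_left (Real.exp_le_exp.2 ?_) (by positivity)
    simp only [NNReal.coe_one, sub_zero, mul_one]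
    nlinarith [mul_nonneg (sub_nonneg.2 hrs) (sub_nonneg.2 hx.le)]
  · rw [Set.indicator_of_notMem (show x + (s - r) ∉ Set.Ioi s by
      simp only [Set.mem_Ioi]; linarith)]
    exact zero_le

/-- The hazard rate of the `χ²₁` distribution is at least `1 / 2`. -/
theorem chiSq1_real_Ioi_le {u v : ℝ} (hu : 0 ≤ u) (huv : u ≤ v) :
    chiSq1.real (Set.Ioi v) ≤ Real.exp (-(v - u) / 2) * chiSq1.real (Set.Ioi u) := by
  have h := gaussianReal_Ioi_le (Real.sqrt_le_sqrt huv)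
  rw [Real.sq_sqrt hu, Real.sq_sqrt (hu.trans huv)] at h
  rw [measureReal_def, measureReal_def, chiSq1_Ioi_of_nonneg hu,
    chiSq1_Ioi_of_nonneg (hu.trans huv), ← ENNReal.toReal_ofReal (Real.exp_pos (-(v - u) / 2)).le,
    ← ENNReal.toReal_mul, mul_left_comm]
  exact ENNReal.toReal_mono (by finiteness) (by gcongr)

theorem exp_neg_le_chiSq1_real_Ioi {t : ℝ} (ht : 0 ≤ t) :
    Real.exp (-(t + 2)) ≤ chiSq1.real (Set.Ioi t) := by
  have h1 : ENNReal.ofReal (Real.exp (-(t + 2))) ≤ gaussianReal 0 1 (Set.Ioi √t) := by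
    rw [gaussianReal_apply 0 one_ne_zero]
    calc ENNReal.ofReal (Real.exp (-(t + 2)))
        = ∫⁻ _ in Set.Ioo √t (√t + 1), ENNReal.ofReal (Real.exp (-(t + 2))) := by simp
      _ ≤ ∫⁻ x in Set.Ioo √t (√t + 1), gaussianPDF 0 1 x := by
        refine setLIntegral_mono (measurable_gaussianPDF 0 1) fun x hx => ?_
        refine ENNReal.ofReal_le_ofReal ?_
        have h2 : Real.exp (-1) ≤ (√(2 * Real.pi * ((1 : NNReal) : ℝ)))⁻¹ := by
          rw [Real.exp_neg]
          refine inv_anti₀ (by simp only [NNReal.coe_one]; positivity) ?_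
          rw [Real.sqrt_le_left (Real.exp_pos _).le]
          have := Real.pi_lt_d2
          have := Real.exp_one_gt_d9
          simp only [NNReal.coe_one]
          nlinarith
        rw [gaussianPDFReal, show -(t + 2) = -1 + -(t + 1) by ring, Real.exp_add]
        refine mul_le_mul h2 (Real.exp_le_exp.2 ?_) (Real.exp_pos _).le (by positivity)
        simp only [NNReal.coe_one, sub_zero, mul_one]
        have h3 : x ^ 2 ≤ (√t + 1) ^ 2 :=
          pow_le_pow_left₀ ((Real.sqrt_nonneg t).trans hx.1.le) hx.2.le 2
        nlinarith [Real.sq_sqrt ht, sq_nonneg (√t - 1)]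
      _ ≤ ∫⁻ x in Set.Ioi √t, gaussianPDF 0 1 x := lintegral_mono_set fun x hx => hx.1
  rw [measureReal_def, chiSq1_Ioi_of_nonneg ht, ← ENNReal.ofReal_le_iff_le_toReal (by finiteness)]
  refine h1.trans ?_
  rw [two_mul]
  exact le_self_add

theorem integrable_id_chiSq1 : Integrable (fun y => y) chiSq1 := by
  rw [chiSq1, integrable_map_measure (by fun_prop) (by fun_prop)]
  exact (memLp_id_gaussianReal (μ := 0) (v := 1) 2).integrable_sq

theorem integral_id_chiSq1 : ∫ y, y ∂chiSq1 = 1 := by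
  rw [chiSq1, integral_map (by fun_prop) (by fun_prop)]
  have h := variance_fun_id_gaussianReal (μ := 0) (v := 1)
  rw [variance_eq_integral (by fun_prop)] at h
  simpa [integral_id_gaussianReal] using h

theorem chiSq1_real_Ioi_pos {t : ℝ} (ht : 0 ≤ t) : 0 < chiSq1.real (Set.Ioi t) :=
  (Real.exp_pos _).trans_le (exp_neg_le_chiSq1_real_Ioi ht)

theorem integral_max_chiSq1 (t : ℝ) : ∫ y, max (y - t) 0 ∂chiSq1 =
    (∫ y in Set.Ioi t, y ∂chiSq1) - t * chiSq1.real (Set.Ioi t) := by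
  have h : (fun y : ℝ => max (y - t) 0) = (Set.Ioi t).indicator fun y => y - t := by
    ext y
    by_cases h : t < y
    · rw [Set.indicator_of_mem (show y ∈ Set.Ioi t from h), max_eq_left (by linarith)]
    · rw [Set.indicator_of_notMem (show y ∉ Set.Ioi t from h), max_eq_right (by linarith)]
  rw [h, integral_indicator measurableSet_Ioi,
    integral_sub integrable_id_chiSq1.integrableOn (integrable_const _), setIntegral_const,
    smul_eq_mul, mul_comm t]

theorem le_condExpGt {t : ℝ} (ht : 0 ≤ t) : t ≤ condExpGt t := by
  have h1 := integral_max_chiSq1 t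
  have h2 : 0 ≤ ∫ y, max (y - t) 0 ∂chiSq1 := integral_nonneg fun _ => le_max_right _ _
  rw [condExpGt, ← measureReal_def, le_div_iff₀ (chiSq1_real_Ioi_pos ht)]
  linarith

theorem one_le_condExpGt {t : ℝ} (ht : 0 ≤ t) : 1 ≤ condExpGt t := by
  rcases le_total 1 t with h | h
  · exact h.trans (le_condExpGt ht)
  rw [condExpGt, ← measureReal_def, le_div_iff₀ (chiSq1_real_Ioi_pos ht), one_mul]
  have hi : IntegrableOn (fun y : ℝ => y - 1) (Set.Ioi t) chiSq1 :=
    integrable_id_chiSq1.integrableOn.sub (integrable_const _)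
  have h1 : ∫ y in Set.Ioi t, (y - 1) ∂chiSq1 =
      (∫ y in Set.Ioi t, y ∂chiSq1) - chiSq1.real (Set.Ioi t) := by
    rw [integral_sub integrable_id_chiSq1.integrableOn (integrable_const _), setIntegral_const,
      smul_eq_mul, mul_one]
  have h2 : ∫ y, (y - 1) ∂chiSq1 = 0 := by
    rw [integral_sub integrable_id_chiSq1 (integrable_const _), integral_id_chiSq1]
    simp
  have h3 : ∫ y, (y - 1) ∂chiSq1 ≤ ∫ y in Set.Ioi t, (y - 1) ∂chiSq1 := by
    rw [← integral_indicator measurableSet_Ioi]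
    refine integral_mono (integrable_id_chiSq1.sub (integrable_const _))
      (hi.integrable_indicator measurableSet_Ioi) fun y => ?_
    by_cases hy : t < y
    · rw [Set.indicator_of_mem (show y ∈ Set.Ioi t from hy)]
    · rw [Set.indicator_of_notMem (show y ∉ Set.Ioi t from hy)]
      linarith
  linarith

theorem neg_log_chiSq1_le {t : ℝ} (ht : 0 ≤ t) :
    -Real.log (chiSq1.real (Set.Ioi t)) ≤ 3 * condExpGt t := by
  have h := (Real.le_log_iff_exp_le (chiSq1_real_Ioi_pos ht)).2 (exp_neg_le_chiSq1_real_Ioi ht)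
  linarith [le_condExpGt ht, one_le_condExpGt ht]

theorem pi_chiSq1_eq_map (n : ℕ) : (Measure.pi fun _ : Fin n => chiSq1) =
    (Measure.pi fun _ : Fin n => gaussianReal 0 1).map fun x i => x i ^ 2 :=
  (Measure.pi_map_pi (μ := fun _ : Fin n => gaussianReal 0 1) (f := fun _ (x : ℝ) => x ^ 2)
    (hμ := fun _ => inferInstanceAs (SigmaFinite chiSq1)) fun _ => by fun_prop).symm

theorem ae_nonneg_pi_chiSq1 (n : ℕ) :
    ∀ᵐ Y ∂(Measure.pi fun _ : Fin n => chiSq1), ∀ i, 0 ≤ Y i := by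
  rw [pi_chiSq1_eq_map, ae_map_iff
    (by fun_prop : Measurable fun (x : Fin n → ℝ) i => x i ^ 2).aemeasurable
    (by simpa only [Set.ofPred_forall] using
      MeasurableSet.iInter fun i => measurableSet_le measurable_const (measurable_pi_apply i))]
  exact Filter.Eventually.of_forall fun x i => sq_nonneg _

theorem measurable_countGt {n : ℕ} : Measurable fun p : (Fin n → ℝ) × ℝ => countGt p.1 p.2 :=
  Finset.measurable_sum _ fun i _ => Measurable.ite
    (measurableSet_lt (by fun_prop) (by fun_prop)) measurable_const measurable_const

theorem measurable_discrepancy {n : ℕ} (k : ℕ) (t : ℝ) :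
    Measurable fun p : (Fin n → ℝ) × ℝ => discrepancy k t p.1 p.2 :=
  Measurable.ite (measurableSet_le (by fun_prop) (by fun_prop))
    ((measurable_const.sub measurable_countGt).max measurable_const)
    ((measurable_countGt.sub measurable_const).max measurable_const)

theorem lintegral_countGt_sub_sq_le (n : ℕ) (u : ℝ) :
    ∫⁻ Y, ENNReal.ofReal ((countGt Y u - n * chiSq1.real (Set.Ioi u)) ^ 2)
      ∂(Measure.pi fun _ : Fin n => chiSq1) ≤ ENNReal.ofReal (n * chiSq1.real (Set.Ioi u)) := by
  set P := Measure.pi fun _ : Fin n => chiSq1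
  set X : ℝ → ℝ := (Set.Ioi u).indicator 1 with hX
  have hXm : Measurable X := measurable_one.indicator measurableSet_Ioi
  have hXL : MemLp X 2 chiSq1 := (memLp_const (1 : ℝ)).indicator measurableSet_Ioi
  have hXi : ∫ y, X y ∂chiSq1 = chiSq1.real (Set.Ioi u) := integral_indicator_one measurableSet_Ioi
  have hXv : Var[X; chiSq1] ≤ chiSq1.real (Set.Ioi u) := by
    refine (variance_le_expectation_sq hXm.aestronglyMeasurable).trans (le_of_eq ?_)
    rw [← hXi]
    refine integral_congr_ae (Filter.Eventually.of_forall fun y => ?_)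
    by_cases hy : u < y <;> simp [hX, hy]
  have hN : (fun Y : Fin n → ℝ => countGt Y u) = ∑ i, fun Y : Fin n → ℝ => X (Y i) := by
    ext Y
    rw [Finset.sum_apply]
    refine Finset.sum_congr rfl fun i _ => ?_
    by_cases hy : u < Y i <;> simp [hX, hy]
  have hL : ∀ i : Fin n, MemLp (fun Y : Fin n → ℝ => X (Y i)) 2 P := fun i =>
    hXL.comp_measurePreserving (measurePreserving_eval _ i)
  have hNL : MemLp (fun Y : Fin n → ℝ => countGt Y u) 2 P := by
    rw [hN]
    exact memLp_finsetSum' _ fun i _ => hL i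
  have hmean : ∫ Y, countGt Y u ∂P = n * chiSq1.real (Set.Ioi u) := by
    have hN' : ∀ Y : Fin n → ℝ, countGt Y u = ∑ i, X (Y i) := fun Y => by
      simpa using congrFun hN Y
    simp_rw [hN']
    rw [integral_finsetSum _ fun i _ => (hL i).integrable (by norm_num)]
    have : ∀ i : Fin n, ∫ Y, X (Y i) ∂P = chiSq1.real (Set.Ioi u) := fun i => by
      rw [← hXi]
      exact integral_comp_eval (μ := fun _ : Fin n => chiSq1) hXm.aestronglyMeasurable
    simp [this]
  have hvar : Var[fun Y => countGt Y u; P] ≤ n * chiSq1.real (Set.Ioi u) := by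
    rw [hN, variance_sum_pi fun _ => hXL]
    simpa using mul_le_mul_of_nonneg_left hXv (Nat.cast_nonneg n)
  rw [variance_eq_integral hNL.aestronglyMeasurable.aemeasurable, hmean] at hvar
  have hInt : Integrable
      (fun Y : Fin n → ℝ => (countGt Y u - n * chiSq1.real (Set.Ioi u)) ^ 2) P :=
    (hNL.sub (memLp_const _)).integrable_sq
  rw [← ofReal_integral_eq_lintegral_ofReal hInt
    (Filter.Eventually.of_forall fun _ => sq_nonneg _)]
  exact ENNReal.ofReal_le_ofReal hvar

theorem lintegral_le_of_le_countGt_sub_sq {n : ℕ} {u : ℝ} {D : (Fin n → ℝ) → ℝ} {α β : ℝ}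
    (hα : 0 ≤ α) (hβ : 0 ≤ β)
    (h : ∀ Y, D Y ≤ α * (countGt Y u - n * chiSq1.real (Set.Ioi u)) ^ 2 + β) :
    ∫⁻ Y, ENNReal.ofReal (D Y) ∂(Measure.pi fun _ : Fin n => chiSq1) ≤
      ENNReal.ofReal (α * (n * chiSq1.real (Set.Ioi u)) + β) := by
  have hm : Measurable fun Y : Fin n → ℝ => countGt Y u :=
    measurable_countGt.comp (measurable_id.prodMk measurable_const)
  calc ∫⁻ Y, ENNReal.ofReal (D Y) ∂(Measure.pi fun _ : Fin n => chiSq1)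
      ≤ ∫⁻ Y, (ENNReal.ofReal α *
          ENNReal.ofReal ((countGt Y u - n * chiSq1.real (Set.Ioi u)) ^ 2) + ENNReal.ofReal β)
          ∂(Measure.pi fun _ : Fin n => chiSq1) := by
        refine lintegral_mono fun Y => ?_
        rw [← ENNReal.ofReal_mul hα, ← ENNReal.ofReal_add (by positivity) hβ]
        exact ENNReal.ofReal_le_ofReal (h Y)
    _ ≤ ENNReal.ofReal α * ENNReal.ofReal (n * chiSq1.real (Set.Ioi u)) + ENNReal.ofReal β := by
        rw [lintegral_add_right _ measurable_const, lintegral_const_mul _ (by fun_prop),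
          lintegral_const, measure_univ, mul_one]
        gcongr
        exact lintegral_countGt_sub_sq_le n u
    _ = _ := by
        rw [← ENNReal.ofReal_mul hα, ← ENNReal.ofReal_add (by positivity) hβ]

theorem le_sq_div_add_div_two {x a : ℝ} (ha : 0 < a) : |x| ≤ 1 / (2 * a) * x ^ 2 + a / 2 := by
  have h : 1 / (2 * a) * x ^ 2 + a / 2 - |x| = (|x| - a) ^ 2 / (2 * a) := by
    rw [sub_sq, sq_abs]
    field_simp
    ring
  have : 0 ≤ (|x| - a) ^ 2 / (2 * a) := by positivity
  linarith

theorem lintegral_discrepancy_le {n k : ℕ} (hk : 0 < k) {t u : ℝ} (ht : 0 ≤ t) (hu : 0 ≤ u)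
    (hkt : n * chiSq1.real (Set.Ioi t) = k) :
    ∫⁻ Y, ENNReal.ofReal (discrepancy k t Y u) ∂(Measure.pi fun _ : Fin n => chiSq1) ≤
      ENNReal.ofReal (8 * √k * Real.exp (-|u - t| / 4)) := by
  have hk0 : (0 : ℝ) < k := Nat.cast_pos.2 hk
  have hk1 : (1 : ℝ) ≤ k := Nat.one_le_cast.2 hk
  have hs1 : 1 ≤ √(k : ℝ) := Real.one_le_sqrt.2 hk1
  have hss : √(k : ℝ) ^ 2 = k := Real.sq_sqrt hk0.le
  have hn0 : (0 : ℝ) ≤ n := Nat.cast_nonneg n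
  rcases le_or_gt u t with hut | hut
  · have hm : (k : ℝ) ≤ Real.exp (-(t - u) / 2) * (n * chiSq1.real (Set.Ioi u)) := by
      have := mul_le_mul_of_nonneg_left (chiSq1_real_Ioi_le hu hut) hn0
      rw [hkt] at this
      linarith
    simp only [discrepancy, hut, if_true]
    rcases le_or_gt (t - u) 1 with hx | hx
    · refine (lintegral_le_of_le_countGt_sub_sq (u := t) (α := 1 / (2 * √k)) (β := √k / 2)
        (by positivity) (by positivity) fun Y => ?_).trans (ENNReal.ofReal_le_ofReal ?_)
      · refine le_trans ?_ (le_sq_div_add_div_two (by positivity))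
        rw [hkt]
        refine max_le ?_ (abs_nonneg _)
        refine le_trans ?_ (neg_le_abs _)
        have : countGt Y t ≤ countGt Y u := by
          refine Finset.sum_le_sum fun i _ => ?_
          by_cases h : t < Y i
          · simp [h, hut.trans_lt h]
          · simp only [h, if_false]
            split_ifs <;> norm_num
        linarith
      · rw [hkt]
        have e1 : 1 / (2 * √(k : ℝ)) * k + √k / 2 = √k := by
          nth_rw 2 [← hss]
          field_simp
          norm_num
        have e2 : 3 / 4 ≤ Real.exp (-|u - t| / 4) := by
          rw [abs_of_nonpos (by linarith)]
          linarith [Real.add_one_le_exp (-(-(u - t)) / 4)]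
        rw [e1]
        nlinarith
    · set m := n * chiSq1.real (Set.Ioi u) with hmdef
      have he : Real.exp (-(t - u) / 2) ≤ 5 / 8 := by
        refine (Real.exp_le_exp.2 (show -(t - u) / 2 ≤ -(1 / 2) by linarith)).trans ?_
        rw [Real.exp_neg]
        have h2 : Real.exp (1 / 2) ^ 2 = Real.exp 1 := by rw [← Real.exp_nat_mul]; norm_num
        have := Real.exp_one_gt_d9
        have h3 : 8 / 5 ≤ Real.exp (1 / 2) := by nlinarith [Real.exp_pos (1 / 2)]
        exact (inv_anti₀ (by norm_num) h3).trans (by norm_num)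
      have hm0 : 0 < m := by
        have := hk0.trans_le hm
        exact pos_of_mul_pos_right this (Real.exp_pos _).le
      have hmk : 3 / 8 * m ≤ m - k := by nlinarith
      have hmk0 : 0 < m - k := by linarith
      refine (lintegral_le_of_le_countGt_sub_sq (u := u) (α := k / (m - k) ^ 2) (β := 0)
        (by positivity) le_rfl fun Y => ?_).trans (ENNReal.ofReal_le_ofReal ?_)
      · rw [← hmdef, add_zero, div_mul_eq_mul_div, le_div_iff₀ (by positivity)]
        have hN : 0 ≤ countGt Y u := Finset.sum_nonneg fun i _ => by split_ifs <;> norm_num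
        rcases le_total (countGt Y u) k with h | h
        · rw [max_eq_left (by linarith)]
          refine mul_le_mul (by linarith) ?_ (by positivity) hk0.le
          nlinarith
        · rw [max_eq_right (by linarith), zero_mul]
          positivity
      · rw [← hmdef, add_zero, div_mul_eq_mul_div, div_le_iff₀ (by positivity)]
        have e1 : Real.exp (-(t - u) / 2) ≤ Real.exp (-|u - t| / 4) := by
          rw [abs_of_nonpos (by linarith)]
          exact Real.exp_le_exp.2 (by linarith)
        have e2 : (k : ℝ) ≤ √k * (Real.exp (-|u - t| / 4) * m) := by
          have h1 : (k : ℝ) ≤ Real.exp (-|u - t| / 4) * m :=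
            hm.trans (mul_le_mul_of_nonneg_right e1 hm0.le)
          refine h1.trans ?_
          exact le_mul_of_one_le_left (by positivity) hs1
        have e3 : (3 / 8 * m) ^ 2 ≤ (m - k) ^ 2 := pow_le_pow_left₀ (by positivity) hmk 2
        have e4 : 0 ≤ 8 * √k * Real.exp (-|u - t| / 4) := by positivity
        have e5 := mul_le_mul_of_nonneg_left e3 e4
        have e6 := mul_le_mul_of_nonneg_right e2 hm0.le
        have e7 : 0 ≤ (k : ℝ) * m := by positivity
        nlinarith
  · simp only [discrepancy, not_le.2 hut, if_false]
    set m := n * chiSq1.real (Set.Ioi u) with hmdef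
    have hm : m ≤ Real.exp (-(u - t) / 2) * k := by
      have := mul_le_mul_of_nonneg_left (chiSq1_real_Ioi_le ht hut.le) hn0
      rw [← hkt]
      linarith
    have hmk : m ≤ k := hm.trans (mul_le_of_le_one_left hk0.le
      (Real.exp_le_one_iff.2 (by linarith)))
    set a := √k * Real.exp (-|u - t| / 4) with ha
    have ha0 : 0 < a := by positivity
    have ham : m ≤ a ^ 2 := by
      rw [ha, mul_pow, hss, ← Real.exp_nat_mul, abs_of_pos (by linarith)]
      refine hm.trans (le_of_eq ?_)
      rw [mul_comm]
      congr 2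
      push_cast
      ring
    refine (lintegral_le_of_le_countGt_sub_sq (u := u) (α := 1 / (2 * a)) (β := a / 2)
      (by positivity) (by positivity) fun Y => ?_).trans (ENNReal.ofReal_le_ofReal ?_)
    · refine le_trans ?_ (le_sq_div_add_div_two ha0)
      rw [← hmdef]
      exact max_le ((by linarith : _ ≤ countGt Y u - m).trans (le_abs_self _)) (abs_nonneg _)
    · rw [← hmdef, mul_assoc, ← ha]
      have : 1 / (2 * a) * m ≤ 1 / (2 * a) * a ^ 2 := by gcongr
      have e : 1 / (2 * a) * a ^ 2 = a / 2 := by field_simp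
      linarith

theorem lintegral_Ioi_exp_neg_abs_sub_le {c : ℝ} (hc : 0 ≤ c) (t : ℝ) :
    ∫⁻ u in Set.Ioi 0, ENNReal.ofReal (c * Real.exp (-|u - t| / 4)) ≤
      ENNReal.ofReal (8 * c) := by
  have h8 : ∫ u : ℝ, Real.exp (-|u| / 4) = 8 := by
    have h := integral_comp_abs (f := fun u : ℝ => Real.exp (-u / 4))
    rw [h]
    have := integral_exp_mul_Ioi (a := -(1 / 4)) (by norm_num) 0
    have e : ∀ x : ℝ, -x / 4 = -(1 / 4) * x := fun x => by ring
    simp_rw [e, this]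
    norm_num
  have hi : Integrable fun u : ℝ => Real.exp (-|u| / 4) := by
    by_contra h
    rw [integral_undef h] at h8
    norm_num at h8
  refine (setLIntegral_le_lintegral _ _).trans ?_
  rw [← ofReal_integral_eq_lintegral_ofReal ((hi.comp_sub_right t).const_mul c)
    (Filter.Eventually.of_forall fun u => by positivity), integral_const_mul,
    integral_sub_right_eq_self (fun u : ℝ => Real.exp (-|u| / 4)), h8, mul_comm]

theorem topSum_nonneg {n k : ℕ} (hk : k ≤ n) {Y : Fin n → ℝ} (hY : ∀ i, 0 ≤ Y i) :
    0 ≤ topSum n k Y := by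
  obtain ⟨S, -, h⟩ := exists_topSum_eq hk Y
  exact h ▸ Finset.sum_nonneg fun i _ => hY i

theorem integrable_add_sum_max (n k : ℕ) (t : ℝ) :
    Integrable (fun Y : Fin n → ℝ => k * t + ∑ i, max (Y i - t) 0)
      (Measure.pi fun _ : Fin n => chiSq1) :=
  (integrable_const _).add <| integrable_finsetSum _ fun _ _ =>
    integrable_comp_eval (μ := fun _ : Fin n => chiSq1) (f := fun y : ℝ => max (y - t) 0)
      ((integrable_id_chiSq1.sub (integrable_const t)).sup (integrable_const 0))

theorem integral_add_sum_max {n k : ℕ} {t : ℝ} (ht : 0 ≤ t)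
    (hkt : n * chiSq1.real (Set.Ioi t) = k) :
    ∫ Y : Fin n → ℝ, (k * t + ∑ i, max (Y i - t) 0) ∂(Measure.pi fun _ : Fin n => chiSq1) =
      k * condExpGt t := by
  have hi : Integrable (fun y : ℝ => max (y - t) 0) chiSq1 :=
    (integrable_id_chiSq1.sub (integrable_const t)).sup (integrable_const 0)
  have hpos := chiSq1_real_Ioi_pos ht
  rw [integral_add (integrable_const _) (integrable_finsetSum _ fun _ _ =>
    integrable_comp_eval (μ := fun _ : Fin n => chiSq1) (f := fun y : ℝ => max (y - t) 0) hi),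
    integral_finsetSum _ fun _ _ => integrable_comp_eval (μ := fun _ : Fin n => chiSq1) (f := fun y : ℝ => max (y - t) 0) hi]
  have : ∀ i : Fin n, ∫ Y : Fin n → ℝ, max (Y i - t) 0 ∂(Measure.pi fun _ : Fin n => chiSq1) =
      ∫ y, max (y - t) 0 ∂chiSq1 := fun i =>
    integral_comp_eval (μ := fun _ : Fin n => chiSq1) (f := fun y : ℝ => max (y - t) 0)
      hi.aestronglyMeasurable
  simp_rw [this, integral_max_chiSq1]
  rw [condExpGt, ← measureReal_def, ← hkt]
  simp only [integral_const, probReal_univ, smul_eq_mul, one_mul, Finset.sum_const,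
    Finset.card_univ, Fintype.card_fin, nsmul_eq_mul]
  field_simp
  ring

theorem integrable_topSum {n k : ℕ} (hk : k ≤ n) :
    Integrable (topSum n k) (Measure.pi fun _ : Fin n => chiSq1) := by
  refine (integrable_add_sum_max n k 0).mono' (measurable_topSum n k).aestronglyMeasurable ?_
  filter_upwards [ae_nonneg_pi_chiSq1 n] with Y hY
  rw [Real.norm_of_nonneg (topSum_nonneg hk hY)]
  exact topSum_le_add_sum_max hk Y 0

theorem integral_topSum_le {n k : ℕ} (hk : k ≤ n) {t : ℝ} (ht : 0 ≤ t)
    (hkt : n * chiSq1.real (Set.Ioi t) = k) :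
    ∫ Y, topSum n k Y ∂(Measure.pi fun _ : Fin n => chiSq1) ≤ k * condExpGt t := by
  rw [← integral_add_sum_max ht hkt]
  exact integral_mono (integrable_topSum hk) (integrable_add_sum_max n k t)
    fun Y => topSum_le_add_sum_max hk Y t

theorem le_integral_topSum {n k : ℕ} (hk0 : 0 < k) (hk : k ≤ n) {t : ℝ} (ht : 0 ≤ t)
    (hkt : n * chiSq1.real (Set.Ioi t) = k) :
    k * condExpGt t ≤ ∫ Y, topSum n k Y ∂(Measure.pi fun _ : Fin n => chiSq1) + 64 * √k := by
  set P := Measure.pi fun _ : Fin n => chiSq1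
  have hpos : 0 ≤ ∫ Y, topSum n k Y ∂P := integral_nonneg_of_ae <| by
    filter_upwards [ae_nonneg_pi_chiSq1 n] with Y hY using topSum_nonneg hk hY
  rw [← integral_add_sum_max ht hkt, ← ENNReal.ofReal_le_ofReal_iff (by positivity),
    ENNReal.ofReal_add hpos (by positivity),
    ofReal_integral_eq_lintegral_ofReal (integrable_add_sum_max n k t)
      (Filter.Eventually.of_forall fun Y => by positivity),
    ofReal_integral_eq_lintegral_ofReal (integrable_topSum hk) (by
      filter_upwards [ae_nonneg_pi_chiSq1 n] with Y hY using topSum_nonneg hk hY)]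
  calc ∫⁻ Y : Fin n → ℝ, ENNReal.ofReal (k * t + ∑ i, max (Y i - t) 0) ∂P
      ≤ ∫⁻ Y, (ENNReal.ofReal (topSum n k Y) +
          ∫⁻ u in Set.Ioi (0 : ℝ), ENNReal.ofReal (discrepancy k t Y u)) ∂P := by
        refine lintegral_mono_ae ?_
        filter_upwards [ae_nonneg_pi_chiSq1 n] with Y hY
          using add_sum_max_le_topSum_add hk hY ht
    _ = ∫⁻ Y, ENNReal.ofReal (topSum n k Y) ∂P +
          ∫⁻ Y, (∫⁻ u in Set.Ioi (0 : ℝ), ENNReal.ofReal (discrepancy k t Y u)) ∂P :=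
        lintegral_add_left (measurable_topSum n k).ennreal_ofReal _
    _ = ∫⁻ Y, ENNReal.ofReal (topSum n k Y) ∂P +
          ∫⁻ u in Set.Ioi (0 : ℝ), ∫⁻ Y, ENNReal.ofReal (discrepancy k t Y u) ∂P := by
        congr 1
        exact lintegral_lintegral_swap
          (f := fun Y u => ENNReal.ofReal (discrepancy k t Y u)) (measurable_discrepancy k t).ennreal_ofReal.aemeasurable
    _ ≤ ∫⁻ Y, ENNReal.ofReal (topSum n k Y) ∂P +
          ∫⁻ u in Set.Ioi 0, ENNReal.ofReal (8 * √k * Real.exp (-|u - t| / 4)) := by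
        refine add_le_add le_rfl ?_
        exact setLIntegral_mono (by fun_prop) fun u hu =>
          lintegral_discrepancy_le hk0 ht (Set.mem_Ioi.1 hu).le hkt
    _ ≤ ∫⁻ Y, ENNReal.ofReal (topSum n k Y) ∂P + ENNReal.ofReal (64 * √k) := by
        refine add_le_add le_rfl ?_
        refine (lintegral_Ioi_exp_neg_abs_sub_le (by positivity) t).trans (le_of_eq ?_)
        congr 1
        ring

theorem abs_integral_sqrt_topSum_sub_le {n k : ℕ} (hk0 : 0 < k) (hk : k ≤ n) {t : ℝ}
    (ht : 0 ≤ t) (hkt : n * chiSq1.real (Set.Ioi t) = k) :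
    |∫ x, √(topSum n k (fun i => x i ^ 2) / k) ∂(Measure.pi fun _ : Fin n => gaussianReal 0 1) -
      √(condExpGt t)| ≤ 72 / (√k * √(condExpGt t)) := by
  set γ := Measure.pi fun _ : Fin n => gaussianReal 0 1
  set F : (Fin n → ℝ) → ℝ := fun x => √(topSum n k (fun i => x i ^ 2) / k)
  set m := ∫ x, F x ∂γ
  set T := √(condExpGt t)
  have hkp : (0 : ℝ) < k := Nat.cast_pos.2 hk0
  have hs1 : 1 ≤ √(k : ℝ) := Real.one_le_sqrt.2 (Nat.one_le_cast.2 hk0)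
  have hss : √(k : ℝ) * √k = k := Real.mul_self_sqrt hkp.le
  have hA := one_le_condExpGt ht
  have hT1 : 1 ≤ T := Real.one_le_sqrt.2 hA
  have hTT : T ^ 2 = condExpGt t := Real.sq_sqrt (by linarith)
  have hm0 : 0 ≤ m := integral_nonneg fun _ => Real.sqrt_nonneg _
  have hL : EuclideanLipschitz ((NNReal.sqrt k)⁻¹ : NNReal) F := by
    rw [NNReal.coe_inv, Real.coe_sqrt, NNReal.coe_natCast]
    exact euclideanLipschitz_sqrt_topSum hk
  have hsub := hL.hasSubgaussianMGF
  have hvar : ∫ x, (F x - m) ^ 2 ∂γ ≤ 8 / k := by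
    refine (HasSubgaussianMGF.integral_sq_le (by positivity) hsub).trans (le_of_eq ?_)
    push_cast
    rw [inv_pow, Real.sq_sqrt hkp.le, div_eq_mul_inv]
  have hFF : ∀ x, F x ^ 2 = topSum n k (fun i => x i ^ 2) / k := fun x =>
    Real.sq_sqrt (div_nonneg (topSum_nonneg hk fun i => sq_nonneg _) hkp.le)
  have hd2 : Integrable (fun x => (F x - m) ^ 2) γ := (hsub.memLp 2).integrable_sq
  have hd1 : Integrable (fun x => F x) γ := hL.integrable (by positivity)
  have hmean : ∫ x, F x ^ 2 ∂γ =
      (∫ Y, topSum n k Y ∂(Measure.pi fun _ : Fin n => chiSq1)) / k := by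
    simp_rw [hFF]
    rw [integral_div, pi_chiSq1_eq_map, integral_map
      (by fun_prop : Measurable fun (x : Fin n → ℝ) i => x i ^ 2).aemeasurable
      (measurable_topSum n k).aestronglyMeasurable]
  have hsplit : ∫ x, F x ^ 2 ∂γ = ∫ x, (F x - m) ^ 2 ∂γ + m ^ 2 := by
    have e : ∀ x, F x ^ 2 = (F x - m) ^ 2 + (2 * m * F x - m ^ 2) := fun x => by ring
    simp_rw [e]
    have h1 : Integrable (fun x => 2 * m * F x) γ := hd1.const_mul _
    have h2 : Integrable (fun x => 2 * m * F x - m ^ 2) γ := h1.sub (integrable_const _)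
    rw [integral_add hd2 h2, integral_sub h1 (integrable_const _),
      integral_const_mul]
    simp only [integral_const, probReal_univ, smul_eq_mul, one_mul]
    change _ + (2 * m * m - m ^ 2) = _
    ring
  have hup : m ^ 2 ≤ T ^ 2 := by
    have h1 : 0 ≤ ∫ x, (F x - m) ^ 2 ∂γ := integral_nonneg fun _ => sq_nonneg _
    have h2 : ∫ x, F x ^ 2 ∂γ ≤ condExpGt t := by
      rw [hmean, div_le_iff₀ hkp, mul_comm]
      exact integral_topSum_le hk ht hkt
    linarith
  have hlow : T ^ 2 - m ^ 2 ≤ 72 / √k := by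
    have h1 : condExpGt t ≤ ∫ x, F x ^ 2 ∂γ + 64 / √k := by
      have := le_integral_topSum hk0 hk ht hkt
      have e : 64 / √(k : ℝ) = 64 * √k / k := by
        nth_rw 3 [← hss]
        field_simp
      rw [hmean, e, ← add_div, le_div_iff₀ hkp]
      linarith
    have h2 : (8 : ℝ) / k ≤ 8 / √k := by
      apply div_le_div_of_nonneg_left (by norm_num) (by positivity)
      nlinarith
    have h3 : (72 : ℝ) / √k = 64 / √k + 8 / √k := by ring
    linarith
  have hmT : m ≤ T := (sq_le_sq₀ hm0 (by positivity)).1 hup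
  rw [abs_sub_comm, abs_of_nonneg (by linarith), ← div_div, le_div_iff₀ (by linarith)]
  nlinarith

/-- **Concentration of the top-`k` sum of i.i.d. χ²₁ order statistics.**
With `T_k = √((1/k) Σ_{i≤k} Y_(i))`, `t` defined by `P(Y₁ > t) = k/n` and
`T = √(E(Y₁ | Y₁ > t))`, there is a universal `C > 0` with
`P(|T_k − T| > C/√(k log(n/k)) + ε) ≤ 2 e^{-kε²/2}` for all `ε > 0`, whenever `k/n < 1/5`. -/
theorem topSum_concentration :
    ∃ C : ℝ, 0 < C ∧
      ∀ (n k : ℕ) (t T : ℝ), 0 < k → (k : ℝ) / n < 1 / 5 →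
        chiSq1 (Set.Ioi t) = ENNReal.ofReal ((k : ℝ) / n) →
        T = Real.sqrt (condExpGt t) →
        ∀ ε : ℝ, 0 < ε →
          (Measure.pi fun _ : Fin n => chiSq1)
              {Y | C / Real.sqrt (k * Real.log ((n : ℝ) / k)) + ε <
                    |Real.sqrt (topSum n k Y / k) - T|} ≤
            ENNReal.ofReal (2 * Real.exp (-(k * ε ^ 2) / 2)) := by
  refine ⟨144, by norm_num, ?_⟩
  rintro n k t T hk0 hkn htail rfl ε hε
  have hkp : (0 : ℝ) < k := Nat.cast_pos.2 hk0
  have hreal : chiSq1.real (Set.Ioi t) = k / n := by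
    rw [measureReal_def, htail, ENNReal.toReal_ofReal (by positivity)]
  have ht : 0 ≤ t := by
    by_contra! h
    rw [measureReal_def, chiSq1_Ioi_of_neg h, ENNReal.toReal_one] at hreal
    linarith
  have hn : (0 : ℝ) < n := by
    have := hreal ▸ chiSq1_real_Ioi_pos ht
    exact (div_pos_iff_of_pos_left hkp).1 this
  have hkt : n * chiSq1.real (Set.Ioi t) = k := by
    rw [hreal]
    field_simp
  have hk : k ≤ n := by
    rw [div_lt_iff₀ hn] at hkn
    exact_mod_cast (by linarith : (k : ℝ) ≤ n)
  have hlog : Real.log (n / k) ≤ 3 * condExpGt t := by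
    rw [← inv_div, Real.log_inv, ← hreal]
    exact neg_log_chiSq1_le ht
  have hlog0 : 0 < Real.log (n / k) := by
    rw [← inv_div, Real.log_inv, Left.neg_pos_iff]
    exact Real.log_neg (by positivity) (by linarith)
  have hA := one_le_condExpGt ht
  have hbias := abs_integral_sqrt_topSum_sub_le hk0 hk ht hkt
  have hC : 72 / (√k * √(condExpGt t)) ≤ 144 / √(k * Real.log (n / k)) := by
    rw [div_le_div_iff₀ (by positivity) (by positivity)]
    have : √(k * Real.log (n / k)) ≤ 2 * (√k * √(condExpGt t)) := by
      rw [Real.sqrt_mul hkp.le, mul_left_comm]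
      refine mul_le_mul_of_nonneg_left ?_ (Real.sqrt_nonneg _)
      rw [Real.sqrt_le_left (by positivity), mul_pow, Real.sq_sqrt (by linarith)]
      linarith
    linarith
  have hL : EuclideanLipschitz ((NNReal.sqrt k)⁻¹ : NNReal)
      fun x : Fin n → ℝ => √(topSum n k (fun i => x i ^ 2) / k) := by
    rw [NNReal.coe_inv, Real.coe_sqrt, NNReal.coe_natCast]
    exact euclideanLipschitz_sqrt_topSum hk
  have hm := measurable_topSum n k
  rw [pi_chiSq1_eq_map, Measure.map_apply
    (by fun_prop : Measurable fun (x : Fin n → ℝ) i => x i ^ 2)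
    (measurableSet_lt measurable_const (by fun_prop))]
  refine (measure_mono fun x hx => ?_).trans ((hL.measure_abs_sub_gt_le hε.le).trans (le_of_eq ?_))
  · have hx' : 144 / √(k * Real.log (n / k)) + ε <
        |√(topSum n k (fun i => x i ^ 2) / k) - √(condExpGt t)| := hx
    change ε < |_|
    have := abs_sub_le (√(topSum n k (fun i => x i ^ 2) / k))
      (∫ x, √(topSum n k (fun i => x i ^ 2) / k) ∂(Measure.pi fun _ : Fin n => gaussianReal 0 1))
      (√(condExpGt t))
    linarith
  · congr 3
    have : ((NNReal.sqrt k)⁻¹ : NNReal) ^ 2 = ((k : NNReal))⁻¹ := by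
      rw [inv_pow, NNReal.sq_sqrt]
    rw [← NNReal.coe_pow, this]
    push_cast
    field_simp
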